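/- arXiv:2201.09971 — 6 statements merged into one kernel-verified Lean document; each statement's English description precedes it below -/
import Mathlib

section
/- For all real numbers a, b with 0 ≤ a ≤ 1 and 0 ≤ b ≤ 1, one has a·b ≤ 1 + a + b − min(a+b, 1) − min((a+b)/2, 1). -/
/-- For all real numbers `a, b` with `0 ≤ a ≤ 1` and `0 ≤ b ≤ 1`, one has
`a·b ≤ 1 + a + b − min(a+b, 1) − min((a+b)/2, 1)`. -/
theorem mul_le_trunc_bound (a b : ℝ) (ha0 : 0 ≤ a) (ha1 : a ≤ 1) (hb0 : 0 ≤ b) (hb1 : b ≤ 1) :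
    a * b ≤ 1 + a + b - min (a + b) 1 - min ((a + b) / 2) 1 := by
  have h₁ : min (a + b) 1 ≤ 1 := min_le_right _ _
  have h₂ : min ((a + b) / 2) 1 ≤ (a + b) / 2 := min_le_left _ _
  have h₃ : a * b ≤ a := mul_le_of_le_one_right ha0 hb1
  have h₄ : a * b ≤ b := mul_le_of_le_one_left hb0 ha1
  linarith
end

section
/- For all real numbers p, q with 0 ≤ p ≤ 1 and 0 ≤ q ≤ 1, and every real λ ≥ 0, one has min(λ·p·q, 1) ≤ min(λ·p, 1) + min(λ·q, 1) − min(λ·(p+q)/2, 1). -/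
/-- For all real numbers `p, q` with `0 ≤ p ≤ 1` and `0 ≤ q ≤ 1`, and every real `λ ≥ 0`,
one has `min(λ·p·q, 1) ≤ min(λ·p, 1) + min(λ·q, 1) − min(λ·(p+q)/2, 1)`. -/
theorem trunc_scaled_mul_le (p q l : ℝ) (hp0 : 0 ≤ p) (hp1 : p ≤ 1)
    (hq0 : 0 ≤ q) (hq1 : q ≤ 1) (hl : 0 ≤ l) :
    min (l * p * q) 1 ≤ min (l * p) 1 + min (l * q) 1 - min (l * (p + q) / 2) 1 := by
  have hlp : l * p * q ≤ l * p := mul_le_of_le_one_right (mul_nonneg hl hp0) hq1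
  have hlq : l * p * q ≤ l * q := by
    rw [mul_right_comm]
    exact mul_le_of_le_one_right (mul_nonneg hl hq0) hp1
  rcases le_total p q with hpq | hqp
  · have hmid : l * (p + q) / 2 ≤ l * q := by linarith [mul_le_mul_of_nonneg_left hpq hl]
    linarith [min_le_min_right 1 hlp, min_le_min_right 1 hmid]
  · have hmid : l * (p + q) / 2 ≤ l * p := by linarith [mul_le_mul_of_nonneg_left hqp hl]
    linarith [min_le_min_right 1 hlq, min_le_min_right 1 hmid]
end

section
/- Fix a mean m on C_b(X). If f, g ∈ C_b(X) are both small, then the pointwise product f · g is small. -/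
open BoundedContinuousFunction

/-- A mean on `C_b(X)`: a linear functional that is positive on nonnegative functions
and sends the constant function `1` to `1`. -/
def IsMean {X : Type*} [TopologicalSpace X] (m : (X →ᵇ ℝ) →ₗ[ℝ] ℝ) : Prop :=
  (∀ f : X →ᵇ ℝ, (∀ x, 0 ≤ f x) → 0 ≤ m f) ∧ m 1 = 1

/-- `m∞(f) = sup_{λ ≥ 0} m(min(λ·f, 1))`, where `min` is the pointwise minimum. -/
noncomputable def mInfty {X : Type*} [TopologicalSpace X]
    (m : (X →ᵇ ℝ) →ₗ[ℝ] ℝ) (f : X →ᵇ ℝ) : ℝ :=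
  ⨆ l : {l : ℝ // 0 ≤ l}, m ((l.1 • f) ⊓ 1)

/-- `f` is small (with respect to the mean `m`) if `f ≥ 0` pointwise and `m∞(f) = 1`. -/
def IsSmall {X : Type*} [TopologicalSpace X] (m : (X →ᵇ ℝ) →ₗ[ℝ] ℝ) (f : X →ᵇ ℝ) : Prop :=
  (∀ x, 0 ≤ f x) ∧ mInfty m f = 1

/-- A mean is monotone. -/
theorem IsMean.mono {X : Type*} [TopologicalSpace X] {m : (X →ᵇ ℝ) →ₗ[ℝ] ℝ} (hm : IsMean m)
    {f g : X →ᵇ ℝ} (h : ∀ x, f x ≤ g x) : m f ≤ m g := by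
  have := hm.1 (g - f) fun x => by simpa using h x
  rw [map_sub] at this
  linarith

/-- Each truncation `m(min(l·f, 1))` is at most `1`. -/
theorem IsMean.smul_inf_one_le {X : Type*} [TopologicalSpace X] {m : (X →ᵇ ℝ) →ₗ[ℝ] ℝ}
    (hm : IsMean m) (f : X →ᵇ ℝ) (l : ℝ) : m ((l • f) ⊓ 1) ≤ 1 :=
  (hm.mono fun _ => min_le_right _ _).trans_eq hm.2

theorem IsMean.mInfty_eq_one_iff {X : Type*} [TopologicalSpace X] {m : (X →ᵇ ℝ) →ₗ[ℝ] ℝ}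
    (hm : IsMean m) (f : X →ᵇ ℝ) :
    mInfty m f = 1 ↔ ∀ r < 1, ∃ l : ℝ, 0 ≤ l ∧ r < m ((l • f) ⊓ 1) := by
  have : Nonempty {l : ℝ // 0 ≤ l} := ⟨⟨0, le_rfl⟩⟩
  constructor
  · intro h r hr
    obtain ⟨l, hl⟩ := exists_lt_of_lt_ciSup (hr.trans_eq h.symm)
    exact ⟨l.1, l.2, hl⟩
  · intro h
    refine ciSup_eq_of_forall_le_of_forall_lt_exists_gt (fun l => hm.smul_inf_one_le f l.1) ?_
    intro r hr
    obtain ⟨l, hl, hlr⟩ := h r hr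
    exact ⟨⟨l, hl⟩, hlr⟩

/-- For `u, v ∈ [0, 1]` one has `u + v - 1 ≤ u v`; apply this to the truncations of `f` and `g`. -/
theorem IsMean.add_sub_one_le_mul {X : Type*} [TopologicalSpace X] {m : (X →ᵇ ℝ) →ₗ[ℝ] ℝ}
    (hm : IsMean m) {f g : X →ᵇ ℝ} (hf : ∀ x, 0 ≤ f x) (hg : ∀ x, 0 ≤ g x)
    {a b : ℝ} (ha : 0 ≤ a) (hb : 0 ≤ b) :
    m ((a • f) ⊓ 1) + m ((b • g) ⊓ 1) - 1 ≤ m (((a * b) • (f * g)) ⊓ 1) := by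
  rw [← hm.2, ← map_add, ← map_sub]
  refine hm.mono fun x => ?_
  change min (a * f x) 1 + min (b * g x) 1 - 1 ≤ min (a * b * (f x * g x)) 1
  have hu₀ : 0 ≤ min (a * f x) 1 := le_min (mul_nonneg ha (hf x)) zero_le_one
  have hv₀ : 0 ≤ min (b * g x) 1 := le_min (mul_nonneg hb (hg x)) zero_le_one
  have hu : min (a * f x) 1 ≤ 1 := min_le_right _ _
  have hv : min (b * g x) 1 ≤ 1 := min_le_right _ _
  have hmul : min (a * f x) 1 * min (b * g x) 1 ≤ a * f x * (b * g x) :=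
    mul_le_mul (min_le_left _ _) (min_le_left _ _) hv₀ (mul_nonneg ha (hf x))
  exact le_min (by nlinarith) (by linarith)

/-- If `f` and `g` are both small, then the pointwise product `f · g` is small. -/
theorem isSmall_mul {X : Type*} [TopologicalSpace X] [Nonempty X]
    (m : (X →ᵇ ℝ) →ₗ[ℝ] ℝ) (hm : IsMean m) (f g : X →ᵇ ℝ)
    (hf : IsSmall m f) (hg : IsSmall m g) : IsSmall m (f * g) := by
  refine ⟨fun x => mul_nonneg (hf.1 x) (hg.1 x), (hm.mInfty_eq_one_iff _).2 fun r hr => ?_⟩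
  have hr' : (r + 1) / 2 < 1 := by linarith
  obtain ⟨a, ha, hfa⟩ := (hm.mInfty_eq_one_iff f).1 hf.2 _ hr'
  obtain ⟨b, hb, hgb⟩ := (hm.mInfty_eq_one_iff g).1 hg.2 _ hr'
  refine ⟨a * b, mul_nonneg ha hb, ?_⟩
  linarith [hm.add_sub_one_le_mul hf.1 hg.1 ha hb]
end

section
/- Fix a mean m on C_b(X). Let f, g ∈ C_b(X) with 0 ≤ f ≤ 1 and 0 ≤ g ≤ 1 pointwise, and suppose that f + g is small. Then m∞(f·g) ≤ m∞(f) + m∞(g) − 1. -/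
open BoundedContinuousFunction

theorem IsMean.le_mInfty {X : Type*} [TopologicalSpace X] {m : (X →ᵇ ℝ) →ₗ[ℝ] ℝ}
    (hm : IsMean m) (f : X →ᵇ ℝ) {l : ℝ} (hl : 0 ≤ l) : m ((l • f) ⊓ 1) ≤ mInfty m f := by
  refine le_ciSup (f := fun l : {l : ℝ // 0 ≤ l} => m ((l.1 • f) ⊓ 1)) ⟨1, ?_⟩ ⟨l, hl⟩
  rintro _ ⟨k, rfl⟩
  exact (hm.mono fun x => by simp).trans_eq hm.2

theorem mInfty_le {X : Type*} [TopologicalSpace X] {m : (X →ᵇ ℝ) →ₗ[ℝ] ℝ} {f : X →ᵇ ℝ} {c : ℝ}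
    (h : ∀ l : ℝ, 0 ≤ l → m ((l • f) ⊓ 1) ≤ c) : mInfty m f ≤ c :=
  haveI : Nonempty {l : ℝ // 0 ≤ l} := ⟨⟨0, le_rfl⟩⟩
  ciSup_le fun l => h l.1 l.2

theorem min_mul_add_min_add_le {a b k l : ℝ} (ha0 : 0 ≤ a) (ha1 : a ≤ 1) (hb0 : 0 ≤ b)
    (hb1 : b ≤ 1) (hk : 0 ≤ k) (hl : 0 ≤ l) :
    min (k * (a * b)) 1 + min (l * (a + b)) 1 ≤ min ((k + l) * a) 1 + min ((k + l) * b) 1 := by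
  have hab_a : k * (a * b) ≤ k * a :=
    mul_le_mul_of_nonneg_left (mul_le_of_le_one_right ha0 hb1) hk
  have hab_b : k * (a * b) ≤ k * b :=
    mul_le_mul_of_nonneg_left (mul_le_of_le_one_left hb0 ha1) hk
  have hka := mul_nonneg hk ha0
  have hkb := mul_nonneg hk hb0
  have hla := mul_nonneg hl ha0
  have hlb := mul_nonneg hl hb0
  have h₁ := min_le_left (k * (a * b)) 1
  have h₂ := min_le_right (k * (a * b)) 1
  have h₃ := min_le_left (l * (a + b)) 1
  have h₄ := min_le_right (l * (a + b)) 1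
  rcases min_cases ((k + l) * a) 1 with ⟨h, -⟩ | ⟨h, -⟩ <;>
    rcases min_cases ((k + l) * b) 1 with ⟨h', -⟩ | ⟨h', -⟩ <;> rw [h, h'] <;> linarith

/-- If `0 ≤ f ≤ 1`, `0 ≤ g ≤ 1` pointwise and `f + g` is small, then
`m∞(f·g) ≤ m∞(f) + m∞(g) − 1`. -/
theorem mInfty_mul_le {X : Type*} [TopologicalSpace X] [Nonempty X]
    (m : (X →ᵇ ℝ) →ₗ[ℝ] ℝ) (hm : IsMean m) (f g : X →ᵇ ℝ)
    (hf0 : ∀ x, 0 ≤ f x) (hf1 : ∀ x, f x ≤ 1)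
    (hg0 : ∀ x, 0 ≤ g x) (hg1 : ∀ x, g x ≤ 1)
    (hfg : IsSmall m (f + g)) :
    mInfty m (f * g) ≤ mInfty m f + mInfty m g - 1 := by
  have key : ∀ k : ℝ, 0 ≤ k → ∀ l : ℝ, 0 ≤ l →
      m ((k • (f * g)) ⊓ 1) + m ((l • (f + g)) ⊓ 1) ≤ mInfty m f + mInfty m g := by
    intro k hk l hl
    refine le_trans ?_ (add_le_add (hm.le_mInfty f (add_nonneg hk hl))
      (hm.le_mInfty g (add_nonneg hk hl)))
    rw [← map_add, ← map_add]
    refine hm.mono fun x => ?_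
    simpa [mul_add] using min_mul_add_min_add_le (hf0 x) (hf1 x) (hg0 x) (hg1 x) hk hl
  refine mInfty_le fun k hk => ?_
  have h : mInfty m (f + g) ≤ mInfty m f + mInfty m g - m ((k • (f * g)) ⊓ 1) :=
    mInfty_le fun l hl => by linarith [key k hk l hl]
  linarith [hfg.2]
end

section
/- Fix a mean m on C_b(X). Let (f_i)_{i∈ℕ} be a sequence in C_b(X) with 0 ≤ f_i ≤ 1 pointwise for all i, and suppose that f_i + f_j is small for all i ≠ j. Then sup_{i∈ℕ} m∞(f_i) = 1; equivalently, there is no ε > 0 such that m∞(f_i) ≤ 1 − ε for every i. -/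
open BoundedContinuousFunction

/-- If the pairwise minima of a finite family bounded by `1` are dominated by `h`, then its sum
is at most `1` plus the sum of `h` over all off-diagonal pairs. -/
theorem Finset.sum_le_one_add_sum_offDiag {ι : Type*} [DecidableEq ι] (s : Finset ι)
    (g : ι → ℝ) (h : ι × ι → ℝ) (hg : ∀ i ∈ s, g i ≤ 1) (hh : ∀ p ∈ s.offDiag, 0 ≤ h p)
    (hgh : ∀ p ∈ s.offDiag, min (g p.1) (g p.2) ≤ h p) :
    ∑ i ∈ s, g i ≤ 1 + ∑ p ∈ s.offDiag, h p := by
  rcases s.eq_empty_or_nonempty with rfl | hs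
  · simp
  obtain ⟨k, hk, hmax⟩ := s.exists_max_image g hs
  rw [← Finset.add_sum_erase s g hk]
  refine add_le_add (hg k hk) ?_
  have hsub : (s.erase k).map ⟨fun i => (i, k), fun _ _ hab => (Prod.ext_iff.1 hab).1⟩
      ⊆ s.offDiag := by
    intro p hp
    simp only [Finset.mem_map, Finset.mem_erase] at hp
    obtain ⟨i, ⟨hik, hi⟩, rfl⟩ := hp
    exact Finset.mem_offDiag.2 ⟨hi, hk, hik⟩
  refine le_trans ?_ (Finset.sum_le_sum_of_subset_of_nonneg hsub fun p hp _ => hh p hp)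
  rw [Finset.sum_map]
  refine Finset.sum_le_sum fun i hi => ?_
  obtain ⟨hik, hi⟩ := Finset.mem_erase.1 hi
  have := hgh (i, k) (Finset.mem_offDiag.2 ⟨hi, hk, hik⟩)
  rwa [min_eq_left (hmax i hi)] at this

namespace IsMean

variable {X : Type*} [TopologicalSpace X] {m : (X →ᵇ ℝ) →ₗ[ℝ] ℝ}

theorem mono_s11 (hm : IsMean m) {f g : X →ᵇ ℝ} (h : ∀ x, f x ≤ g x) : m f ≤ m g := by
  have := hm.1 (g - f) fun x => by simpa using h x
  rw [map_sub] at this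
  linarith

theorem map_smul_inf_one_le_one (hm : IsMean m) (f : X →ᵇ ℝ) (l : ℝ) :
    m ((l • f) ⊓ 1) ≤ 1 :=
  hm.2 ▸ hm.mono_s11 fun x => by simp

theorem map_smul_inf_one_le_mInfty (hm : IsMean m) (f : X →ᵇ ℝ) {l : ℝ} (hl : 0 ≤ l) :
    m ((l • f) ⊓ 1) ≤ mInfty m f :=
  le_ciSup (f := fun l : {l : ℝ // 0 ≤ l} => m ((l.1 • f) ⊓ 1))
    ⟨1, Set.forall_mem_range.2 fun l => hm.map_smul_inf_one_le_one f l⟩ ⟨l, hl⟩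

theorem mInfty_le_one (hm : IsMean m) (f : X →ᵇ ℝ) : mInfty m f ≤ 1 :=
  have : Nonempty {l : ℝ // 0 ≤ l} := ⟨⟨0, le_rfl⟩⟩
  ciSup_le fun l => hm.map_smul_inf_one_le_one f l

open Filter in
theorem eventually_lt_map_smul_inf_one (hm : IsMean m) {f : X →ᵇ ℝ} (hf : ∀ x, 0 ≤ f x)
    {a : ℝ} (ha : a < mInfty m f) : ∀ᶠ l : ℝ in atTop, a < m ((l • f) ⊓ 1) := by
  have : Nonempty {l : ℝ // 0 ≤ l} := ⟨⟨0, le_rfl⟩⟩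
  obtain ⟨l, hl⟩ := exists_lt_of_lt_ciSup ha
  filter_upwards [eventually_ge_atTop l.1] with k hk
  refine hl.trans_le (hm.mono_s11 fun x => ?_)
  exact min_le_min_right 1 (mul_le_mul_of_nonneg_right hk (hf x))

open Filter in
/-- The values `m∞(fᵢ)` are not bounded away from `1`: for large `l`, the functions
`1 - min (2 l fᵢ) 1` have pairwise minima of small mean, so their means sum to at most `2`. -/
theorem not_forall_mInfty_le (hm : IsMean m) {f : ℕ → (X →ᵇ ℝ)}
    (hf : ∀ i x, 0 ≤ f i x) (hsum : ∀ i j, i ≠ j → IsSmall m (f i + f j)) {ε : ℝ}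
    (hε : 0 < ε) : ¬ ∀ i, mInfty m (f i) ≤ 1 - ε := by
  intro hle
  obtain ⟨N, hN⟩ := exists_nat_gt (2 / ε)
  rw [div_lt_iff₀ hε] at hN
  set s := Finset.range N
  set c := (s.offDiag.card : ℝ)
  have hδ : 0 < 1 / (c + 1) := by positivity
  have hev : ∀ᶠ l : ℝ in atTop, ∀ p ∈ s.offDiag,
      1 - 1 / (c + 1) < m ((l • (f p.1 + f p.2)) ⊓ 1) := by
    refine (Finset.eventually_all _).2 fun p hp => ?_
    obtain ⟨h0, h1⟩ := hsum p.1 p.2 (Finset.mem_offDiag.1 hp).2.2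
    exact hm.eventually_lt_map_smul_inf_one h0 (by linarith)
  obtain ⟨l, hl, hl0⟩ := (hev.and (eventually_ge_atTop 0)).exists
  have key : m (∑ i ∈ s, (1 - ((2 * l) • f i) ⊓ 1)) ≤
      m (1 + ∑ p ∈ s.offDiag, (1 - (l • (f p.1 + f p.2)) ⊓ 1)) := by
    refine hm.mono_s11 fun x => ?_
    simp only [coe_sum, Finset.sum_apply, coe_add, Pi.add_apply, coe_one, Pi.one_apply]
    refine s.sum_le_one_add_sum_offDiag _ _ (fun i _ => ?_) (fun p _ => ?_) fun p _ => ?_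
    · have := mul_nonneg hl0 (hf i x)
      simp
      linarith
    · simp
    · have h1 := mul_nonneg hl0 (hf p.1 x)
      have h2 := mul_nonneg hl0 (hf p.2 x)
      simp
      grind
  simp only [map_add, map_sum, map_sub, hm.2] at key
  have hlow : ∑ _i ∈ s, ε ≤ ∑ i ∈ s, (1 - m (((2 * l) • f i) ⊓ 1)) :=
    Finset.sum_le_sum fun i _ => by
      linarith [hle i, hm.map_smul_inf_one_le_mInfty (f i) (mul_nonneg zero_le_two hl0)]
  have hup : ∑ p ∈ s.offDiag, (1 - m ((l • (f p.1 + f p.2)) ⊓ 1)) ≤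
      ∑ _p ∈ s.offDiag, 1 / (c + 1) :=
    Finset.sum_le_sum fun p hp => by linarith [hl p hp]
  have hc : c * (1 / (c + 1)) ≤ 1 := by
    rw [mul_one_div, div_le_one (by positivity)]
    linarith
  simp only [Finset.sum_const, nsmul_eq_mul] at hlow hup
  rw [Finset.card_range] at hlow
  linarith

end IsMean

/-- If `(fᵢ)_{i ∈ ℕ}` is a sequence with `0 ≤ fᵢ ≤ 1` pointwise and `fᵢ + fⱼ` is small for
all `i ≠ j`, then `sup_i m∞(fᵢ) = 1`; equivalently there is no `ε > 0` with
`m∞(fᵢ) ≤ 1 − ε` for every `i`. -/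
theorem iSup_mInfty_eq_one {X : Type*} [TopologicalSpace X] [Nonempty X]
    (m : (X →ᵇ ℝ) →ₗ[ℝ] ℝ) (hm : IsMean m) (f : ℕ → (X →ᵇ ℝ))
    (hf : ∀ i, ∀ x, 0 ≤ f i x ∧ f i x ≤ 1)
    (hsum : ∀ i j, i ≠ j → IsSmall m (f i + f j)) :
    (⨆ i : ℕ, mInfty m (f i)) = 1 ∧ ¬ ∃ ε > (0 : ℝ), ∀ i, mInfty m (f i) ≤ 1 - ε := by
  have hnot : ¬ ∃ ε > (0 : ℝ), ∀ i, mInfty m (f i) ≤ 1 - ε := fun ⟨_, hε, h⟩ =>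
    hm.not_forall_mInfty_le (fun i x => (hf i x).1) hsum hε h
  refine ⟨le_antisymm (ciSup_le fun i => hm.mInfty_le_one _) ?_, hnot⟩
  by_contra! hlt
  refine hnot ⟨1 - ⨆ i, mInfty m (f i), sub_pos.2 hlt, fun i => ?_⟩
  rw [sub_sub_cancel]
  exact le_ciSup (f := fun i => mInfty m (f i))
    ⟨1, Set.forall_mem_range.2 fun i => hm.mInfty_le_one _⟩ i
end

section
/- Let X be a nonempty topological space and A a closed subalgebra of the Banach algebra C_b(X) of bounded continuous real-valued functions on X (with the supremum norm) containing the constant functions. Then the set Σ of means on A is a nonempty convex weak-* compact subset of the continuous dual of A, and Σ equals the weak-* closed convex hull of the set of multiplicative means on A. -/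
open BoundedContinuousFunction

set_option synthInstance.maxHeartbeats 1000000
set_option maxHeartbeats 1000000

/-- The set of means on a subalgebra `A` of `C_b(X)`, viewed inside the continuous dual of
`A` equipped with the weak-* topology: the continuous linear functionals `m : A → ℝ` that
are nonnegative on pointwise-nonnegative functions and send the constant function `1`
to `1`. -/
def meanSet {X : Type*} [TopologicalSpace X] (A : Subalgebra ℝ (X →ᵇ ℝ)) :
    Set (WeakDual ℝ A) :=
  {m | (∀ f : A, (∀ x, 0 ≤ (f : X →ᵇ ℝ) x) → 0 ≤ m f) ∧ m 1 = 1}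

section WeakDual

theorem WeakDual.exists_separating_of_notMem_closure_convexHull {E : Type*} [AddCommGroup E]
    [Module ℝ E] [TopologicalSpace E] {s : Set (WeakDual ℝ E)} {m : WeakDual ℝ E}
    (hm : m ∉ closure (convexHull ℝ s)) : ∃ (f : E) (u : ℝ), (∀ n ∈ s, n f < u) ∧ u < m f := by
  have : LocallyConvexSpace ℝ (WeakDual ℝ E) :=
    inferInstanceAs (LocallyConvexSpace ℝ (WeakBilin (topDualPairing ℝ E)))
  obtain ⟨φ, u, hu, hum⟩ :=
    geometric_hahn_banach_closed_point (convex_convexHull ℝ s).closure isClosed_closure hm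
  obtain ⟨f, hf⟩ := LinearMap.dualEmbedding_surjective (topDualPairing ℝ E) φ
  have hφ : ∀ n : WeakDual ℝ E, φ n = n f := fun n => (DFunLike.congr_fun hf n).symm
  refine ⟨f, u, fun n hn => ?_, hφ m ▸ hum⟩
  rw [← hφ]
  exact hu n (subset_closure (subset_convexHull ℝ s hn))

theorem WeakDual.isCompact_of_isClosed_of_norm_apply_le {E : Type*} [SeminormedAddCommGroup E]
    [NormedSpace ℝ E] {s : Set (WeakDual ℝ E)} (hs : IsClosed s) {C : ℝ} (hC : 0 ≤ C)
    (h : ∀ m ∈ s, ∀ f, ‖m f‖ ≤ C * ‖f‖) : IsCompact s := by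
  refine (WeakDual.isCompact_closedBall (0 : StrongDual ℝ E) C).of_isClosed_subset hs
    fun m hm => ?_
  rw [Set.mem_preimage, mem_closedBall_zero_iff]
  exact ContinuousLinearMap.opNorm_le_bound _ hC (h m hm)

end WeakDual

section Means

variable {X : Type*} [TopologicalSpace X] {A : Subalgebra ℝ (X →ᵇ ℝ)}

theorem apply_le_of_mem_meanSet {m : WeakDual ℝ A} (hm : m ∈ meanSet A) {f : A} {c : ℝ}
    (hf : ∀ x, (f : X →ᵇ ℝ) x ≤ c) : m f ≤ c := by
  have h := hm.1 (c • 1 - f) fun x => by simpa using hf x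
  have h' : m (c • 1 - f) = c * m 1 - m f := by
    rw [show m (c • 1 - f) = m (c • 1) - m f from
      ContinuousLinearMap.map_sub (m : A →L[ℝ] ℝ) (c • 1) f]
    exact congrArg (· - m f) (map_smul m c 1)
  rw [h', hm.2] at h
  linarith

theorem norm_apply_le_of_mem_meanSet {m : WeakDual ℝ A} (hm : m ∈ meanSet A) (f : A) :
    ‖m f‖ ≤ ‖f‖ := by
  have hf : ∀ x, |(f : X →ᵇ ℝ) x| ≤ ‖f‖ := fun x => (f : X →ᵇ ℝ).norm_coe_le_norm x
  have h := apply_le_of_mem_meanSet hm (f := -f) (c := ‖f‖) fun x => by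
    simpa using neg_le.mp (abs_le.mp (hf x)).1
  have h_neg : m (-f) = -m f := ContinuousLinearMap.map_neg (m : A →L[ℝ] ℝ) f
  rw [h_neg] at h
  exact abs_le.mpr ⟨neg_le.mp h, apply_le_of_mem_meanSet hm fun x => (abs_le.mp (hf x)).2⟩

theorem convex_meanSet : Convex ℝ (meanSet A) := by
  intro m hm n hn a b ha hb hab
  refine ⟨fun f hf => ?_, ?_⟩
  · exact add_nonneg (mul_nonneg ha (hm.1 f hf)) (mul_nonneg hb (hn.1 f hf))
  · change a * m 1 + b * n 1 = 1
    rw [hm.2, hn.2, mul_one, mul_one, hab]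

theorem isClosed_meanSet : IsClosed (meanSet A) := by
  have h : meanSet A = (⋂ (f : A) (_ : ∀ x, 0 ≤ (f : X →ᵇ ℝ) x), {m : WeakDual ℝ A | 0 ≤ m f}) ∩
      {m | m 1 = 1} := by
    ext m
    simp [meanSet]
  rw [h]
  exact (isClosed_iInter fun f => isClosed_iInter fun _ =>
    isClosed_le continuous_const (WeakDual.eval_continuous f)).inter
      (isClosed_eq (WeakDual.eval_continuous 1) continuous_const)

theorem isCompact_meanSet : IsCompact (meanSet A) :=
  WeakDual.isCompact_of_isClosed_of_norm_apply_le (E := A.toSubmodule) isClosed_meanSet zero_le_one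
    fun _ hm f => (norm_apply_le_of_mem_meanSet hm f).trans_eq (one_mul _).symm

variable (A) in
/-- Evaluation at a point, as an element of the weak dual of `A`. -/
noncomputable def pointEvaluation (x : X) : WeakDual ℝ A :=
  StrongDual.toWeakDual ((BoundedContinuousFunction.evalCLM ℝ x).comp A.toSubmodule.subtypeL)

theorem pointEvaluation_mem_meanSet (x : X) : pointEvaluation A x ∈ meanSet A :=
  ⟨fun _ hf => hf x, rfl⟩

theorem pointEvaluation_mul (x : X) (f g : A) :
    pointEvaluation A x (f * g) = pointEvaluation A x f * pointEvaluation A x g := rfl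

/-- By the Hahn–Banach theorem, the means are the weak-* limits of convex combinations of point
evaluations. -/
theorem meanSet_subset_closure_convexHull_pointEvaluation :
    meanSet A ⊆ closure (convexHull ℝ (Set.range (pointEvaluation A))) := by
  intro m hm
  by_contra hmem
  obtain ⟨f, u, hu, hum⟩ := WeakDual.exists_separating_of_notMem_closure_convexHull (E := A) hmem
  exact hum.not_ge (apply_le_of_mem_meanSet hm fun x => (hu _ (Set.mem_range_self x)).le)

end Means

/-- The set of means on a closed unital subalgebra `A` of `C_b(X)` (for `X` nonempty) is a
nonempty convex weak-* compact subset of the continuous dual of `A`, and it equals the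
weak-* closed convex hull of the set of multiplicative means on `A`. -/
theorem meanSet_eq_closure_convexHull_multiplicative
    {X : Type*} [TopologicalSpace X] [Nonempty X]
    (A : Subalgebra ℝ (X →ᵇ ℝ)) (hA : IsClosed (A : Set (X →ᵇ ℝ))) :
    (meanSet A).Nonempty ∧ Convex ℝ (meanSet A) ∧ IsCompact (meanSet A) ∧
      meanSet A =
        closure (convexHull ℝ
          {m ∈ meanSet A | ∀ f g : A, m (f * g) = m f * m g}) := by
  refine ⟨?_, convex_meanSet, isCompact_meanSet, Set.Subset.antisymm ?_ ?_⟩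
  · exact ⟨_, pointEvaluation_mem_meanSet (Classical.arbitrary X)⟩
  · refine meanSet_subset_closure_convexHull_pointEvaluation.trans
      (closure_mono (convexHull_mono ?_))
    rintro _ ⟨x, rfl⟩
    exact ⟨pointEvaluation_mem_meanSet x, pointEvaluation_mul x⟩
  · exact closure_minimal (convexHull_min (Set.sep_subset _ _) convex_meanSet) isClosed_meanSet
end
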